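/- (One-sided selection identity.) Let k, l be natural numbers with 1 ≤ k, and assume N · gcd(2k, M) < M. Then for all ν, n ∈ S with μ(n) − μ(ν) = −(k·N : ZMod M), the N-photon matrix element satisfies Γ(L_{k,l} + (L_{k,l})ᴴ)[ν,n] = ω^{l·μ(n)} if ν = σ^k n, and Γ(L_{k,l} + (L_{k,l})ᴴ)[ν,n] = 0 otherwise. -/

import Mathlib

open Matrix Complex BigOperators Finset

noncomputable section

set_option linter.unusedVariables false

/-- `ω = exp(2πi/M)`. -/
def hwOmega (M : ℕ) : ℂ := Complex.exp (2 * Real.pi * Complex.I / M)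

/-- Single-photon Heisenberg–Weyl matrix `L_{k,l} = X^k Z^l`,
with entries `L_{k,l}[m,m'] = ω^{l·m'}` if `m = m' + k` and `0` otherwise. -/
def HW (M : ℕ) [NeZero M] (k l : ZMod M) : Matrix (ZMod M) (ZMod M) ℂ :=
  Matrix.of fun m m' => if m = m' + k then hwOmega M ^ (l * m').val else 0

/-- Fock vectors: mode-occupation functions `ZMod M → ℕ` with total photon number `N`. -/
abbrev Fock (M N : ℕ) [NeZero M] := {n : ZMod M → ℕ // ∑ m, n m = N}

instance (M N : ℕ) [NeZero M] : Fintype (Fock M N) :=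
  Fintype.ofInjective
    (fun n (m : ZMod M) => (⟨n.1 m, Nat.lt_succ_of_le (le_of_le_of_eq
      (Finset.single_le_sum (fun i _ => Nat.zero_le _) (Finset.mem_univ m)) n.2)⟩ : Fin (N+1)))
    (fun a b h => Subtype.ext (funext fun m => congrArg Fin.val (congrFun h m)))

/-- The mode shift `σ`, `(σ n)(m) = n(m - 1)`. -/
def modeShift (M N : ℕ) [NeZero M] (n : Fock M N) : Fock M N :=
  ⟨fun m => n.1 (m - 1), by
    exact (Fintype.sum_equiv (Equiv.subRight (1 : ZMod M)) _ _ (fun m => rfl)).trans n.2⟩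

/-- The total mode index `μ(n) = ∑ m, m·n(m) ∈ ZMod M`. -/
def tmi (M N : ℕ) [NeZero M] (n : Fock M N) : ZMod M := ∑ m : ZMod M, m * (n.1 m : ZMod M)

/-- Multiphoton Heisenberg–Weyl matrix `Λ_{k,l}`, with entries `ω^{l·μ(n)}` at `(σ^k n, n)`
and `0` elsewhere. -/
def HWm (M N : ℕ) [NeZero M] (k l : ZMod M) : Matrix (Fock M N) (Fock M N) ℂ :=
  Matrix.of fun v n =>
    if v = (modeShift M N)^[k.val] n then hwOmega M ^ (l * tmi M N n).val else 0

/-- `f : Fin N → ZMod M` enumerates the Fock vector `n`: each fiber `f⁻¹{m}` has `n(m)` elements. -/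
def IsEnum (M N : ℕ) [NeZero M] (n : Fock M N) (f : Fin N → ZMod M) : Prop :=
  ∀ m : ZMod M, (Finset.univ.filter fun i => f i = m).card = n.1 m

theorem hwOmega_pow_self (M : ℕ) [NeZero M] : hwOmega M ^ M = 1 :=
  (Complex.isPrimitiveRoot_exp M (NeZero.ne M)).pow_eq_one

theorem hwOmega_pow_val_add (M : ℕ) [NeZero M] (a b : ZMod M) :
    hwOmega M ^ (a + b).val = hwOmega M ^ a.val * hwOmega M ^ b.val := by
  rw [← pow_add, ZMod.val_add, ← pow_eq_pow_mod _ (hwOmega_pow_self M)]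

theorem hwOmega_pow_val_sum (M : ℕ) [NeZero M] {ι : Type*} (s : Finset ι) (a : ι → ZMod M) :
    hwOmega M ^ (∑ i ∈ s, a i).val = ∏ i ∈ s, hwOmega M ^ (a i).val := by
  classical
  induction s using Finset.induction_on with
  | empty => simp
  | insert i s hi ih => rw [sum_insert hi, prod_insert hi, hwOmega_pow_val_add, ih]

/-- The total mode index is the sum of the modes listed by any enumeration. -/
theorem IsEnum.sum_eq_tmi {M N : ℕ} [NeZero M] {n : Fock M N} {g : Fin N → ZMod M}
    (hg : IsEnum M N n g) : ∑ i, g i = tmi M N n := by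
  rw [tmi, ← Finset.sum_fiberwise univ g g]
  refine Finset.sum_congr rfl fun m _ => ?_
  rw [Finset.sum_congr rfl (g := fun _ => m) (by simp), sum_const, hg m, nsmul_eq_mul, mul_comm]

theorem modeShift_iterate_apply (M N k : ℕ) [NeZero M] (n : Fock M N) (m : ZMod M) :
    ((modeShift M N)^[k] n).1 m = n.1 (m - k) := by
  induction k generalizing m with
  | zero => simp
  | succ k ih =>
    rw [Function.iterate_succ_apply']
    change ((modeShift M N)^[k] n).1 (m - 1) = _
    rw [ih, sub_sub, Nat.cast_succ, add_comm]

/-- Two maps with equal finite fibre sizes `c` are related by `∏ c!` permutations. -/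
theorem card_perm_comp_eq {ι α : Type*} [Fintype ι] [DecidableEq ι] [Fintype α] [DecidableEq α]
    (f h : ι → α) [DecidablePred fun τ : Equiv.Perm ι => ∀ i, f (τ i) = h i]
    (hfh : ∀ a, #{i | f i = a} = #{i | h i = a}) :
    #{τ : Equiv.Perm ι | ∀ i, f (τ i) = h i} = ∏ a, Nat.factorial #{i | h i = a} := by
  have hcard (a : α) : Fintype.card {i // h i = a} = Fintype.card {i // f i = a} := by
    rw [Fintype.card_subtype, Fintype.card_subtype, hfh]
  let e : Equiv.Perm ι := Equiv.ofFiberEquiv fun a => Fintype.equivOfCardEq (hcard a)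
  have he (i : ι) : f (e i) = h i := Equiv.ofFiberEquiv_map _ i
  have key := DomMulAct.stabilizer_card h
  simp only [Fintype.card_subtype] at key
  rw [← key]
  refine Finset.card_equiv (Equiv.mulLeft e⁻¹) fun τ => ?_
  simp only [mem_filter, mem_univ, true_and, funext_iff, Function.comp_apply, Equiv.coe_mulLeft,
    Equiv.Perm.mul_apply, ← he, Equiv.Perm.inv_def, Equiv.apply_symm_apply]

/-- If a signed sum of `N` steps `±k` equals `N * k` modulo `M`, no step is negative. -/
theorem eq_univ_of_signed_sum {M N k : ℕ} [NeZero M] (hkM : N * Nat.gcd (2 * k) M < M)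
    (s : Finset (Fin N)) (f g : Fin N → ZMod M)
    (hsum : ∑ i, f i = ∑ i, g i + (k * N : ℕ))
    (hs : ∀ i ∈ s, f i = g i + k) (hsc : ∀ i ∈ sᶜ, g i = f i + k) : s = univ := by
  have h₁ : ∑ i ∈ s, f i = ∑ i ∈ s, g i + #s * k := by
    rw [sum_congr rfl hs, sum_add_distrib, sum_const, nsmul_eq_mul]
  have h₂ : ∑ i ∈ sᶜ, g i = ∑ i ∈ sᶜ, f i + #sᶜ * k := by
    rw [sum_congr rfl hsc, sum_add_distrib, sum_const, nsmul_eq_mul]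
  have hc : (#s : ZMod M) + #sᶜ = N := by
    rw [← Nat.cast_add, card_add_card_compl, Fintype.card_fin]
  have hz : ((2 * k * #sᶜ : ℕ) : ZMod M) = 0 := by
    rw [← sum_add_sum_compl s f, ← sum_add_sum_compl s g] at hsum
    push_cast at hsum ⊢
    linear_combination -hsum + h₁ - h₂ + (k : ZMod M) * hc
  have hdvd : M ∣ #sᶜ * Nat.gcd (2 * k) M := by
    rw [← Nat.gcd_mul_left]
    refine Nat.dvd_gcd ?_ (Dvd.intro_left _ rfl)
    rw [mul_comm]
    exact (ZMod.natCast_eq_zero_iff _ _).1 hz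
  have hle : #sᶜ ≤ N := (card_le_univ _).trans_eq (Fintype.card_fin N)
  have h0 := Nat.eq_zero_of_dvd_of_lt hdvd ((Nat.mul_le_mul_right _ hle).trans_lt hkM)
  rcases Nat.mul_eq_zero.1 h0 with h | h
  · simpa using h
  · exact absurd (Nat.gcd_eq_zero_iff.1 h).2 (NeZero.ne M)

/-- Only the all-`L` term survives in the expansion of a product of entries of `L + Lᴴ`. -/
theorem prod_HW_add_conjTranspose {M N k : ℕ} [NeZero M] (l : ZMod M)
    (hkM : N * Nat.gcd (2 * k) M < M) (f g : Fin N → ZMod M)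
    (hsum : ∑ i, f i = ∑ i, g i + (k * N : ℕ)) :
    ∏ i, (HW M k l + (HW M k l)ᴴ) (f i) (g i) = ∏ i, HW M k l (f i) (g i) := by
  simp only [Matrix.add_apply]
  rw [Fintype.prod_add, Finset.sum_eq_single univ]
  · simp
  · intro s _ hs
    by_contra hne
    rw [← ne_eq, mul_ne_zero_iff, prod_ne_zero_iff, prod_ne_zero_iff] at hne
    refine hs (eq_univ_of_signed_sum hkM s f g hsum (fun i hi => ?_) fun i hi => ?_)
    · by_contra h
      exact hne.1 i hi (by simp [HW, h])
    · by_contra h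
      exact hne.2 i hi (by simp [HW, h])
  · simp

theorem prod_HW {M N : ℕ} [NeZero M] (k l : ZMod M) (f g : Fin N → ZMod M) :
    ∏ i, HW M k l (f i) (g i) =
      if ∀ i, f i = g i + k then hwOmega M ^ (l * ∑ i, g i).val else 0 := by
  simp only [HW, Matrix.of_apply]
  rw [mul_sum, hwOmega_pow_val_sum, Finset.prod_ite_zero]
  simp

/-- one-sided selection identity: for `1 ≤ k`, `N·gcd(2k,M) < M` and
`μ(n) − μ(ν) = −kN`, the `N`-photon matrix element of `L_{k,l} + (L_{k,l})ᴴ` is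
`ω^{l·μ(n)}` if `ν = σ^k n` and `0` otherwise. -/
theorem one_sided_selection (M N : ℕ) [NeZero M] (hN : 1 ≤ N) (k l : ℕ)
    (hk : 1 ≤ k) (hkM : N * Nat.gcd (2 * k) M < M) (ν n : Fock M N)
    (hμ : tmi M N n - tmi M N ν = -((k * N : ℕ) : ZMod M))
    (f g : Fin N → ZMod M) (hf : IsEnum M N ν f) (hg : IsEnum M N n g) :
    Matrix.permanent (Matrix.of fun i j : Fin N =>
        (HW M (k : ZMod M) (l : ZMod M) + (HW M (k : ZMod M) (l : ZMod M))ᴴ) (f i) (g j)) /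
        (Real.sqrt (((∏ m, Nat.factorial (ν.1 m)) * ∏ m, Nat.factorial (n.1 m) : ℕ)) : ℂ) =
      if ν = (modeShift M N)^[k] n then hwOmega M ^ ((l : ZMod M) * tmi M N n).val else 0 := by
  have hsum : ∑ i, f i = ∑ i, g i + (k * N : ℕ) := by
    rw [hf.sum_eq_tmi, hg.sum_eq_tmi]
    linear_combination -hμ
  have hperm : Matrix.permanent (Matrix.of fun i j : Fin N =>
      (HW M (k : ZMod M) (l : ZMod M) + (HW M (k : ZMod M) (l : ZMod M))ᴴ) (f i) (g j)) =
      #{τ : Equiv.Perm (Fin N) | ∀ i, f (τ i) = g i + k} *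
        hwOmega M ^ ((l : ZMod M) * tmi M N n).val := by
    simp only [Matrix.permanent, Matrix.of_apply]
    rw [← hg.sum_eq_tmi, ← nsmul_eq_mul, ← sum_const, sum_filter]
    refine sum_congr rfl fun τ _ => ?_
    rw [prod_HW_add_conjTranspose _ hkM (fun i => f (τ i)) g
      ((Equiv.sum_comp τ f).trans hsum), prod_HW]
  have hshift (m : ZMod M) : #{i | g i + k = m} = ((modeShift M N)^[k] n).1 m := by
    rw [modeShift_iterate_apply, ← hg]
    simp only [eq_sub_iff_add_eq]
  rw [hperm]
  split_ifs with h
  · have hprod : ∏ m, Nat.factorial (ν.1 m) = ∏ m, Nat.factorial (n.1 m) := by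
      simp only [h, modeShift_iterate_apply]
      exact Equiv.prod_comp (Equiv.subRight (k : ZMod M)) fun m => Nat.factorial (n.1 m)
    have hcount := card_perm_comp_eq f (fun i => g i + k) fun m => by rw [hshift, hf, h]
    simp only [hshift, ← h, hprod] at hcount
    have hne : (∏ m, Nat.factorial (n.1 m)) ≠ 0 :=
      prod_ne_zero_iff.2 fun m _ => Nat.factorial_ne_zero _
    rw [hcount, hprod, Nat.cast_mul, Real.sqrt_mul_self (Nat.cast_nonneg _), Complex.ofReal_natCast,
      mul_div_cancel_left₀ _ (Nat.cast_ne_zero.2 hne)]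
  · have hcount : #{τ : Equiv.Perm (Fin N) | ∀ i, f (τ i) = g i + k} = 0 := by
      refine card_eq_zero.2 (filter_eq_empty_iff.2 fun τ _ hτ =>
        h (Subtype.ext (funext fun m => ?_)))
      rw [← hf, ← hshift]
      exact (card_equiv τ fun i => by simp [hτ]).symm
    simp [hcount]

end
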